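/- Let (X, b, s) be a b-metric space with coefficient s ≥ 1 and let S : X → X. Suppose there exist an A_R-simulation function J whose sequence condition holds with the same coefficient s (with associated F ∈ 𝔉_c having constant c ≥ 1 and ϑ ∈ Θ*) such that for all x, y ∈ X with Sx ≠ Sy, J(ϑ(b(Sx,Sy)), ϑ(max{b(x,y), b(x,Sx), b(y,Sy), (b(Sx,y) + b(x,Sy))/(2s)})) ≥ c. Let a_0 ∈ X, set a_n = S^n a_0, and assume b(a_n, a_{n+1}) > 0 for all n ≥ 0. Then the Picard sequence (a_n) is Cauchy: for every ε > 0 there exists N such that b(a_n, a_m) < ε for all n, m ≥ N. -/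

import Mathlib

open Filter Topology

/-- A b-metric on `X` with coefficient `s`. -/
def IsBMetric {X : Type*} (b : X → X → ℝ) (s : ℝ) : Prop :=
  (∀ x y, 0 ≤ b x y) ∧
  (∀ x y, b x y = 0 ↔ x = y) ∧
  (∀ x y, b x y = b y x) ∧
  (∀ x y z, b x z ≤ s * (b x y + b y z))

/-- A sequence is Cauchy with respect to a b-metric. -/
def BCauchy {X : Type*} (b : X → X → ℝ) (u : ℕ → X) : Prop :=
  ∀ ε > (0 : ℝ), ∃ N : ℕ, ∀ k ≥ N, ∀ m ≥ N, b (u k) (u m) < ε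

/-- Completeness of a b-metric space: every Cauchy sequence converges. -/
def BComplete {X : Type*} (b : X → X → ℝ) : Prop :=
  ∀ u : ℕ → X, BCauchy b u → ∃ z : X, Tendsto (fun n => b (u n) z) atTop (𝓝 0)

/-- `S` is b-continuous: it preserves convergence of sequences. -/
def BContinuousMap {X : Type*} (b : X → X → ℝ) (S : X → X) : Prop :=
  ∀ (u : ℕ → X) (x : X), Tendsto (fun n => b (u n) x) atTop (𝓝 0) →
    Tendsto (fun n => b (S (u n)) (S x)) atTop (𝓝 0)

/-- The class `Θ*` of auxiliary functions `ϑ : (0,∞) → (1,∞)`: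
increasing, continuous, and `ϑ(aₙ) → 1` iff `aₙ → 0`. -/
def ThetaStar (ϑ : ℝ → ℝ) : Prop :=
  (∀ x, 0 < x → 1 < ϑ x) ∧
  MonotoneOn ϑ (Set.Ioi 0) ∧
  ContinuousOn ϑ (Set.Ioi 0) ∧
  ∀ u : ℕ → ℝ, (∀ n, 0 < u n) →
    (Tendsto (fun n => ϑ (u n)) atTop (𝓝 1) ↔ Tendsto u atTop (𝓝 0))

/-- The class `𝔉_c` of functions `F : [1,∞) × [1,∞) → ℝ` with constant `c ≥ 1`. -/
def FcClass (F : ℝ → ℝ → ℝ) (c : ℝ) : Prop :=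
  ContinuousOn (fun p : ℝ × ℝ => F p.1 p.2) (Set.Ici 1 ×ˢ Set.Ici 1) ∧
  (∀ x y, 1 ≤ x → 1 ≤ y → F x y ≤ x) ∧
  (∀ x y, 1 ≤ x → 1 ≤ y → F x y = x → x = 1 ∨ y = 1) ∧
  1 ≤ c ∧
  (∀ x y, 1 ≤ x → 1 ≤ y → c < F x y → y < x) ∧
  (∀ x, 1 ≤ x → F x x ≤ c)

/-- The condition on a pair of positive sequences appearing in the definition of an
`A_R`-simulation function with coefficient `s`:
`0 < liminf uₙ ≤ s·limsup vₙ ≤ s²·liminf uₙ < ∞` and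
`0 < liminf vₙ ≤ s·limsup uₙ ≤ s²·liminf vₙ < ∞` (computed in the extended reals). -/
def SeqCond (s : ℝ) (u v : ℕ → ℝ) : Prop :=
  (0 < Filter.liminf (fun n => ((u n : EReal))) atTop ∧
    Filter.liminf (fun n => ((u n : EReal))) atTop ≤
      (s : EReal) * Filter.limsup (fun n => ((v n : EReal))) atTop ∧
    (s : EReal) * Filter.limsup (fun n => ((v n : EReal))) atTop ≤
      ((s ^ 2 : ℝ) : EReal) * Filter.liminf (fun n => ((u n : EReal))) atTop ∧
    ((s ^ 2 : ℝ) : EReal) * Filter.liminf (fun n => ((u n : EReal))) atTop < ⊤) ∧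
  (0 < Filter.liminf (fun n => ((v n : EReal))) atTop ∧
    Filter.liminf (fun n => ((v n : EReal))) atTop ≤
      (s : EReal) * Filter.limsup (fun n => ((u n : EReal))) atTop ∧
    (s : EReal) * Filter.limsup (fun n => ((u n : EReal))) atTop ≤
      ((s ^ 2 : ℝ) : EReal) * Filter.liminf (fun n => ((v n : EReal))) atTop ∧
    ((s ^ 2 : ℝ) : EReal) * Filter.liminf (fun n => ((v n : EReal))) atTop < ⊤)

/-- `J` is an `A_R`-simulation function with data `s`, `F ∈ 𝔉_c` (constant `c`), `ϑ ∈ Θ*`. -/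
def ARSimulation (J : ℝ → ℝ → ℝ) (s : ℝ) (F : ℝ → ℝ → ℝ) (c : ℝ) (ϑ : ℝ → ℝ) : Prop :=
  (∀ x y : ℝ, 1 < x → 1 < y → J x y < F y x) ∧
  ∀ u v : ℕ → ℝ, (∀ n, 0 < u n) → (∀ n, 0 < v n) → SeqCond s u v →
    Filter.limsup (fun n => J (ϑ (u n)) (ϑ (v n))) atTop < c

theorem exists_coe_liminf_limsup_of_bounds {u w : ℕ → ℝ} {ε L : ℝ} (hu : ∀ n, ε ≤ u n)
    (huw : ∀ n, u n ≤ w n) (hw : Tendsto w atTop (𝓝 L)) :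
    ∃ l m : ℝ, liminf (fun n => (u n : EReal)) atTop = l ∧
      limsup (fun n => (u n : EReal)) atTop = m ∧ ε ≤ l ∧ l ≤ m ∧ m ≤ L := by
  have hw' : Tendsto (fun n => (w n : EReal)) atTop (𝓝 (L : EReal)) :=
    (continuous_coe_real_ereal.tendsto L).comp hw
  have h₁ : (ε : EReal) ≤ liminf (fun n => (u n : EReal)) atTop :=
    le_liminf_of_le (by isBoundedDefault) (.of_forall fun n => by exact_mod_cast hu n)
  have h₂ : liminf (fun n => (u n : EReal)) atTop ≤ limsup (fun n => (u n : EReal)) atTop :=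
    liminf_le_limsup
  have h₃ : limsup (fun n => (u n : EReal)) atTop ≤ L := by
    rw [← hw'.limsup_eq]
    exact limsup_le_limsup (.of_forall fun n => EReal.coe_le_coe_iff.2 (huw n))
  generalize liminf (fun n => (u n : EReal)) atTop = l at *
  generalize limsup (fun n => (u n : EReal)) atTop = m at *
  have hl : l ≠ ⊥ := ((EReal.bot_lt_coe ε).trans_le h₁).ne'
  have hm : m ≠ ⊤ := (h₃.trans_lt (EReal.coe_lt_top L)).ne
  lift m to ℝ using ⟨hm, ((bot_lt_iff_ne_bot.2 hl).trans_le h₂).ne'⟩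
  lift l to ℝ using ⟨(h₂.trans_lt (EReal.coe_lt_top m)).ne, hl⟩
  exact ⟨l, m, rfl, rfl, by exact_mod_cast h₁, by exact_mod_cast h₂, by exact_mod_cast h₃⟩

theorem seqCond_of_bounds {u v w : ℕ → ℝ} {s ε : ℝ} (hs : 1 ≤ s) (hε : 0 < ε)
    (hu : ∀ n, ε ≤ u n) (hv : ∀ n, ε ≤ v n) (huw : ∀ n, u n ≤ w n) (hvw : ∀ n, v n ≤ w n)
    (hw : Tendsto w atTop (𝓝 (s * ε))) : SeqCond s u v := by
  obtain ⟨l, m, hl, hm, hεl, hlm, hmL⟩ := exists_coe_liminf_limsup_of_bounds hu huw hw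
  obtain ⟨l', m', hl', hm', hεl', hlm', hmL'⟩ := exists_coe_liminf_limsup_of_bounds hv hvw hw
  unfold SeqCond
  rw [hl, hm, hl', hm']
  simp only [← EReal.coe_mul, EReal.coe_le_coe_iff, EReal.coe_pos, EReal.coe_lt_top, and_true]
  have hs₀ : 0 ≤ s := zero_le_one.trans hs
  have h₁ : s * ε ≤ s * l := mul_le_mul_of_nonneg_left hεl hs₀
  have h₂ : s * ε ≤ s * l' := mul_le_mul_of_nonneg_left hεl' hs₀
  have h₃ : s * l ≤ s * m := mul_le_mul_of_nonneg_left hlm hs₀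
  have h₄ : s * l' ≤ s * m' := mul_le_mul_of_nonneg_left hlm' hs₀
  refine ⟨⟨by linarith, by linarith, ?_⟩, by linarith, by linarith, ?_⟩
  · rw [sq, mul_assoc]
    exact mul_le_mul_of_nonneg_left (by linarith) hs₀
  · rw [sq, mul_assoc]
    exact mul_le_mul_of_nonneg_left (by linarith) hs₀

theorem ARSimulation.exists_lt_of_bounds {J F : ℝ → ℝ → ℝ} {s c : ℝ} {ϑ : ℝ → ℝ}
    (hJ : ARSimulation J s F c ϑ) (hϑ : ThetaStar ϑ) (hF : FcClass F c) (hs : 1 ≤ s)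
    {u v w : ℕ → ℝ} {ε : ℝ} (hε : 0 < ε)
    (hu : ∀ n, ε ≤ u n) (hv : ∀ n, ε ≤ v n) (huw : ∀ n, u n ≤ w n) (hvw : ∀ n, v n ≤ w n)
    (hw : Tendsto w atTop (𝓝 (s * ε))) : ∃ n, J (ϑ (u n)) (ϑ (v n)) < c := by
  by_contra! hc
  have hu₀ n : 0 < u n := hε.trans_le (hu n)
  have hv₀ n : 0 < v n := hε.trans_le (hv n)
  refine (hJ.2 u v hu₀ hv₀ (seqCond_of_bounds hs hε hu hv huw hvw hw)).not_ge ?_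
  obtain ⟨B, hB⟩ := hw.bddAbove_range
  have hvB n : v n ≤ B := (hvw n).trans (hB ⟨n, rfl⟩)
  have hle n : J (ϑ (u n)) (ϑ (v n)) ≤ ϑ B :=
    calc J (ϑ (u n)) (ϑ (v n))
        ≤ F (ϑ (v n)) (ϑ (u n)) := (hJ.1 _ _ (hϑ.1 _ (hu₀ n)) (hϑ.1 _ (hv₀ n))).le
      _ ≤ ϑ (v n) := hF.2.1 _ _ (hϑ.1 _ (hv₀ n)).le (hϑ.1 _ (hu₀ n)).le
      _ ≤ ϑ B := hϑ.2.1 (hv₀ n) ((hv₀ n).trans_le (hvB n)) (hvB n)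
  exact le_limsup_of_frequently_le (.of_forall hc) (isBoundedUnder_of ⟨ϑ B, hle⟩)

theorem ARSimulation.lt_of_le {J F : ℝ → ℝ → ℝ} {s c : ℝ} {ϑ : ℝ → ℝ}
    (hJ : ARSimulation J s F c ϑ) (hϑ : ThetaStar ϑ) (hF : FcClass F c)
    {x y : ℝ} (hx : 0 < x) (hy : 0 < y) (h : c ≤ J (ϑ x) (ϑ y)) : x < y := by
  have hϑx := hϑ.1 x hx
  have hϑy := hϑ.1 y hy
  have hlt : ϑ x < ϑ y :=
    hF.2.2.2.2.1 _ _ hϑy.le hϑx.le (h.trans_lt (hJ.1 _ _ hϑx hϑy))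
  exact hϑ.2.1.reflect_lt hx hy hlt

/-- A sequence that is not Cauchy separates by `ε` at arbitrarily large indices, starting from
a previous term closer than `ε`. -/
theorem exists_first_separation_of_not_bCauchy {X : Type*} {b : X → X → ℝ} {s : ℝ}
    (hb : IsBMetric b s) {a : ℕ → X} (ha : ¬ BCauchy b a) :
    ∃ ε > 0, ∀ N, ∃ p q, N ≤ p ∧ N ≤ q ∧
      ε ≤ b (a (q + 1)) (a (p + 1)) ∧ b (a q) (a (p + 1)) < ε := by
  obtain ⟨-, hb0, hsymm, -⟩ := hb
  unfold BCauchy at ha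
  push Not at ha
  obtain ⟨ε, hε, ha⟩ := ha
  refine ⟨ε, hε, fun N => ?_⟩
  have hself x : b x x < ε := by rwa [(hb0 x x).2 rfl]
  have key : ∃ n m, N + 1 ≤ n ∧ n < m ∧ ε ≤ b (a m) (a n) := by
    obtain ⟨k, hk, m, hm, h⟩ := ha (N + 1)
    rcases lt_trichotomy k m with hkm | rfl | hkm
    · exact ⟨k, m, hk, hkm, by rwa [hsymm]⟩
    · exact absurd h (hself _).not_ge
    · exact ⟨m, k, hm, hkm, h⟩
  obtain ⟨n, m, hn, hnm⟩ := key
  classical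
  have hex : ∃ m, n < m ∧ ε ≤ b (a m) (a n) := ⟨m, hnm⟩
  obtain ⟨hlt, hge⟩ := Nat.find_spec hex
  obtain ⟨q, hq⟩ : ∃ q, Nat.find hex = q + 1 := ⟨Nat.find hex - 1, by omega⟩
  obtain ⟨p, rfl⟩ : ∃ p, n = p + 1 := ⟨n - 1, by omega⟩
  rw [hq] at hlt hge
  refine ⟨p, q, by omega, by omega, hge, ?_⟩
  by_contra! hcon
  rcases (Nat.lt_succ_iff.1 hlt).eq_or_lt with rfl | hpq
  · exact (hself _).not_ge hcon
  · exact Nat.find_min hex (by omega) ⟨hpq, hcon⟩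

/-- For a generalized `𝔍_{A_R}`-contraction, the Picard sequence is Cauchy. -/
theorem picard_sequence_cauchy_generalized {X : Type*} [Nonempty X]
    (b : X → X → ℝ) (s : ℝ) (hs : 1 ≤ s)
    (hb : IsBMetric b s) (S : X → X)
    (J F : ℝ → ℝ → ℝ) (ϑ : ℝ → ℝ) (c : ℝ)
    (hϑ : ThetaStar ϑ) (hF : FcClass F c)
    (hJ : ARSimulation J s F c ϑ)
    (hcontr : ∀ x y : X, S x ≠ S y →
      c ≤ J (ϑ (b (S x) (S y)))
            (ϑ (max (max (b x y) (b x (S x)))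
                (max (b y (S y)) ((b (S x) y + b x (S y)) / (2 * s))))))
    (a₀ : X) (hpos : ∀ n : ℕ, 0 < b (S^[n] a₀) (S^[n + 1] a₀)) :
    BCauchy b (fun n : ℕ => S^[n] a₀) := by
  obtain ⟨-, hb0, hsymm, htri⟩ := id hb
  have hs₀ : 0 < s := zero_lt_one.trans_le hs
  set a : ℕ → X := fun n => S^[n] a₀
  have hsucc n : S (a n) = a (n + 1) := (Function.iterate_succ_apply' S n a₀).symm
  set β : ℕ → ℝ := fun n => b (a n) (a (n + 1))
  replace hpos n : 0 < β n := hpos n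
  set M : ℕ → ℕ → ℝ := fun p q => max (max (b (a p) (a q)) (β p))
    (max (β q) ((b (a (p + 1)) (a q) + b (a p) (a (q + 1))) / (2 * s)))
  have hMpos p q : 0 < M p q := (hpos p).trans_le (le_max_of_le_left (le_max_right _ _))
  have hcM p q (h : 0 < b (a (p + 1)) (a (q + 1))) :
      c ≤ J (ϑ (b (a (p + 1)) (a (q + 1)))) (ϑ (M p q)) := by
    have hne : S (a p) ≠ S (a q) := by
      rw [hsucc, hsucc]
      exact fun he => h.ne' ((hb0 _ _).2 he)
    simpa only [hsucc] using hcontr (a p) (a q) hne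
  have hMle n : M n (n + 1) ≤ max (β n) (β (n + 1)) := by
    refine max_le (max_le (le_max_left _ _) (le_max_left _ _)) (max_le (le_max_right _ _) ?_)
    rw [(hb0 (a (n + 1)) _).2 rfl, zero_add, div_le_iff₀ (by positivity)]
    calc b (a n) (a (n + 1 + 1)) ≤ s * (β n + β (n + 1)) := htri _ _ _
      _ ≤ s * (max (β n) (β (n + 1)) + max (β n) (β (n + 1))) := by
        gcongr
        · exact le_max_left _ _
        · exact le_max_right _ _
      _ = max (β n) (β (n + 1)) * (2 * s) := by ring
  have hdec n : β (n + 1) < β n := by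
    have h := (hJ.lt_of_le hϑ hF (hpos (n + 1)) (hMpos n (n + 1))
      (hcM n (n + 1) (hpos (n + 1)))).trans_le (hMle n)
    exact (lt_max_iff.1 h).resolve_right (lt_irrefl _)
  have hMeq n : M n (n + 1) = β n :=
    ((hMle n).trans_eq (max_eq_left (hdec n).le)).antisymm
      (le_max_of_le_left (le_max_right _ _))
  have hanti : Antitone β := antitone_nat_of_succ_le fun n => (hdec n).le
  have hβ0 : Tendsto β atTop (𝓝 0) := by
    have hbdd : BddBelow (Set.range β) := ⟨0, by rintro _ ⟨n, rfl⟩; exact (hpos n).le⟩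
    have hlim := tendsto_atTop_ciInf hanti hbdd
    have hge n : iInf β ≤ β n := ciInf_le hbdd n
    rcases (le_ciInf fun n => (hpos n).le : 0 ≤ iInf β).eq_or_lt with h0 | h0
    · rwa [← h0] at hlim
    · have hw : Tendsto (fun n => β n + (s - 1) * iInf β) atTop (𝓝 (s * iInf β)) := by
        convert hlim.add_const ((s - 1) * iInf β) using 2
        ring
      have hextra : 0 ≤ (s - 1) * iInf β := mul_nonneg (sub_nonneg.2 hs) h0.le
      obtain ⟨n, hn⟩ := hJ.exists_lt_of_bounds hϑ hF hs (u := fun n => β (n + 1)) (v := β)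
        h0 (fun n => hge (n + 1)) hge (fun n => by linarith [hdec n])
        (fun n => by linarith) hw
      have h := hcM n (n + 1) (hpos (n + 1))
      rw [hMeq] at h
      exact absurd h hn.not_ge
  by_contra hC
  obtain ⟨ε, hε, hsep⟩ := exists_first_separation_of_not_bCauchy hb hC
  choose p q hp hq hfar hnear using hsep
  have hw : Tendsto (fun n => s * ε + 2 * s * β n) atTop (𝓝 (s * ε)) := by
    simpa using (hβ0.const_mul (2 * s)).const_add (s * ε)
  have hβp n : β (p n) ≤ β n := hanti (hp n)
  have hβq n : β (q n) ≤ β n := hanti (hq n)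
  have hsβ n : β n ≤ s * β n := le_mul_of_one_le_left (hpos n).le hs
  have hu n : b (a (q n + 1)) (a (p n + 1)) ≤ s * (β n + ε) := by
    refine (htri _ (a (q n)) _).trans ?_
    rw [hsymm (a (q n + 1))]
    exact mul_le_mul_of_nonneg_left (add_le_add (hβq n) (hnear n).le) hs₀.le
  have hdist n : b (a (q n)) (a (p n)) ≤ s * (ε + β n) := by
    refine (htri _ (a (p n + 1)) _).trans ?_
    rw [hsymm (a (p n + 1))]
    exact mul_le_mul_of_nonneg_left (add_le_add (hnear n).le (hβp n)) hs₀.le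
  have hcross n : b (a (q n + 1)) (a (p n)) ≤ s * (s * (β n + ε) + β n) := by
    refine (htri _ (a (p n + 1)) _).trans ?_
    rw [hsymm (a (p n + 1)) (a (p n))]
    exact mul_le_mul_of_nonneg_left (add_le_add (hu n) (hβp n)) hs₀.le
  have hv n : M (q n) (p n) ≤ s * ε + 2 * s * β n := by
    have hsε : 0 < s * ε := mul_pos hs₀ hε
    refine max_le (max_le ?_ ?_) (max_le ?_ ?_)
    · linarith [hdist n, hsβ n, hpos n]
    · linarith [hβq n, hsβ n, hpos n]
    · linarith [hβp n, hsβ n, hpos n]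
    · rw [div_le_iff₀ (by positivity)]
      have h₁ : s * β n ≤ s * (s * β n) := mul_le_mul_of_nonneg_left (hsβ n) hs₀.le
      have h₂ : ε ≤ s * ε := le_mul_of_one_le_left hε.le hs
      have h₃ : s * ε ≤ s * (s * ε) := mul_le_mul_of_nonneg_left h₂ hs₀.le
      linarith [hcross n, hnear n, hsβ n, hpos n]
  have hc n := hcM (q n) (p n) (hε.trans_le (hfar n))
  obtain ⟨n, hn⟩ := hJ.exists_lt_of_bounds hϑ hF hs hε hfar
    (fun n => (hfar n).trans
      (hJ.lt_of_le hϑ hF (hε.trans_le (hfar n)) (hMpos (q n) (p n)) (hc n)).le)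
    (fun n => by linarith [hu n, hsβ n, hpos n]) hv hw
  exact hn.not_ge (hc n)
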